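/- arXiv:2404.07230 — 8 statements merged into one kernel-verified Lean document; each statement's English description precedes it below -/
import Mathlib

section
/- For all x, y in U, β ≤ SN_x(y) if and only if SN_y ⊆ SN_x. -/
open scoped Classical

/-- An interval value: a closed subinterval `[lo, hi]` of `[0,1]`. -/
structure IV where
  lo : ℝ
  hi : ℝ
  lo_nonneg : 0 ≤ lo
  lo_le_hi : lo ≤ hi
  hi_le_one : hi ≤ 1

namespace IV

@[ext] theorem ext' {a b : IV} (h1 : a.lo = b.lo) (h2 : a.hi = b.hi) : a = b := by
  cases a; cases b; simp_all

/-- Componentwise order, meet and join on interval values. -/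
instance : Lattice IV where
  le a b := a.lo ≤ b.lo ∧ a.hi ≤ b.hi
  le_refl a := ⟨le_refl _, le_refl _⟩
  le_trans a b c hab hbc := ⟨hab.1.trans hbc.1, hab.2.trans hbc.2⟩
  le_antisymm a b hab hba := ext' (le_antisymm hab.1 hba.1) (le_antisymm hab.2 hba.2)
  inf a b := ⟨min a.lo b.lo, min a.hi b.hi, le_min a.lo_nonneg b.lo_nonneg,
    min_le_min a.lo_le_hi b.lo_le_hi, (min_le_left _ _).trans a.hi_le_one⟩
  inf_le_left a b := ⟨min_le_left _ _, min_le_left _ _⟩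
  inf_le_right a b := ⟨min_le_right _ _, min_le_right _ _⟩
  le_inf a b c hab hac := ⟨le_min hab.1 hac.1, le_min hab.2 hac.2⟩
  sup a b := ⟨max a.lo b.lo, max a.hi b.hi, le_max_of_le_left a.lo_nonneg,
    max_le_max a.lo_le_hi b.lo_le_hi, max_le a.hi_le_one b.hi_le_one⟩
  le_sup_left a b := ⟨le_max_left _ _, le_max_left _ _⟩
  le_sup_right a b := ⟨le_max_right _ _, le_max_right _ _⟩
  sup_le a b c hac hbc := ⟨max_le hac.1 hbc.1, max_le hac.2 hbc.2⟩

/-- The top interval value `[1,1]`. -/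
instance : OrderTop IV where
  top := ⟨1, 1, zero_le_one, le_refl 1, le_refl 1⟩
  le_top a := ⟨a.lo_le_hi.trans a.hi_le_one, a.hi_le_one⟩

/-- Complement `[1 - hi, 1 - lo]` of an interval value. -/
def compl (a : IV) : IV :=
  ⟨1 - a.hi, 1 - a.lo, by linarith [a.hi_le_one], by linarith [a.lo_le_hi],
    by linarith [a.lo_nonneg]⟩

end IV

/-- The interval-valued fuzzy soft `β`-neighborhood of `x`:
`SN_x = ⋂ {F e : e ∈ A, β ≤ F e x}` (pointwise infimum, `[1,1]` if the family is empty). -/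
noncomputable def SN {U ι : Type*} [Fintype ι] (F : ι → U → IV) (β : IV) (x : U) :
    U → IV :=
  fun y => (Finset.univ.filter (fun e => β ≤ F e x)).inf (fun e => F e y)

/-- The complementary interval-valued fuzzy soft `β`-neighborhood: `SM_x(y) = SN_y(x)`. -/
noncomputable def SM {U ι : Type*} [Fintype ι] (F : ι → U → IV) (β : IV) (x : U) :
    U → IV :=
  fun y => SN F β y x

/-- The (crisp) soft `β`-neighborhood `N_x = {y : β ≤ SN_x(y)}`. -/
noncomputable def Nbd {U ι : Type*} [Fintype ι] (F : ι → U → IV) (β : IV) (x : U) :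
    Set U :=
  {y | β ≤ SN F β x y}

section Approx

variable {U ι : Type*} [Fintype U] [Nonempty U] [Fintype ι]

/-- First-kind lower approximation. -/
noncomputable def SAlow1 (F : ι → U → IV) (β : IV) (X : U → IV) : U → IV :=
  fun x => Finset.univ.inf' Finset.univ_nonempty (fun y => (SN F β x y).compl ⊔ X y)

/-- First-kind upper approximation. -/
noncomputable def SAupp1 (F : ι → U → IV) (β : IV) (X : U → IV) : U → IV :=
  fun x => Finset.univ.sup' Finset.univ_nonempty (fun y => SN F β x y ⊓ X y)

/-- Second-kind lower approximation. -/
noncomputable def SAlow2 (F : ι → U → IV) (β : IV) (X : U → IV) : U → IV :=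
  fun x => Finset.univ.inf' Finset.univ_nonempty (fun y => (SM F β x y).compl ⊔ X y)

/-- Second-kind upper approximation. -/
noncomputable def SAupp2 (F : ι → U → IV) (β : IV) (X : U → IV) : U → IV :=
  fun x => Finset.univ.sup' Finset.univ_nonempty (fun y => SM F β x y ⊓ X y)

/-- Third-kind lower approximation. -/
noncomputable def SAlow3 (F : ι → U → IV) (β : IV) (X : U → IV) : U → IV :=
  fun x => Finset.univ.inf' Finset.univ_nonempty
    (fun y => (SN F β x y).compl ⊔ (SM F β x y).compl ⊔ X y)

/-- Third-kind upper approximation. -/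
noncomputable def SAupp3 (F : ι → U → IV) (β : IV) (X : U → IV) : U → IV :=
  fun x => Finset.univ.sup' Finset.univ_nonempty
    (fun y => SN F β x y ⊓ SM F β x y ⊓ X y)

/-- Fourth-kind lower approximation. -/
noncomputable def SAlow4 (F : ι → U → IV) (β : IV) (X : U → IV) : U → IV :=
  fun x => Finset.univ.inf' Finset.univ_nonempty
    (fun y => ((SN F β x y).compl ⊓ (SM F β x y).compl) ⊔ X y)

/-- Fourth-kind upper approximation. -/
noncomputable def SAupp4 (F : ι → U → IV) (β : IV) (X : U → IV) : U → IV :=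
  fun x => Finset.univ.sup' Finset.univ_nonempty
    (fun y => (SN F β x y ⊔ SM F β x y) ⊓ X y)

/-- First-kind crisp lower approximation of a crisp set. -/
noncomputable def CL1 (F : ι → U → IV) (β : IV) (X : Set U) : Set U :=
  {x | Nbd F β x ⊆ X}

/-- First-kind crisp upper approximation of a crisp set. -/
noncomputable def CU1 (F : ι → U → IV) (β : IV) (X : Set U) : Set U :=
  {x | (Nbd F β x ∩ X).Nonempty}

end Approx

/-- `β ≤ SN_x(y)` if and only if `SN_y ⊆ SN_x`. -/
theorem stmt3 {U ι : Type*} [Fintype U] [Nonempty U] [Fintype ι]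
    (F : ι → U → IV) (β : IV) :
    ∀ x y : U, β ≤ SN F β x y ↔ ∀ z : U, SN F β y z ≤ SN F β x z := by
  intro x y
  constructor
  · intro h z
    refine Finset.le_inf fun e he => ?_
    have hx : β ≤ F e y := h.trans (Finset.inf_le (f := fun e => F e y) he)
    exact Finset.inf_le (f := fun e => F e z)
      (Finset.mem_filter.mpr ⟨Finset.mem_univ e, hx⟩)
  · intro h
    refine le_trans ?_ (h y)
    exact Finset.le_inf fun e he => (Finset.mem_filter.mp he).2
end

section
/- For all x, y in U, β ≤ SN_x(y) and β ≤ SN_y(x) hold simultaneously if and only if SN_x = SN_y. -/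
open scoped Classical

/-- `β ≤ SN_x(y)` and `β ≤ SN_y(x)` iff `SN_x = SN_y`. -/
theorem stmt4 {U ι : Type*} [Fintype U] [Nonempty U] [Fintype ι]
    (F : ι → U → IV) (β : IV) :
    ∀ x y : U, (β ≤ SN F β x y ∧ β ≤ SN F β y x) ↔ SN F β x = SN F β y := by
  intro x y
  have key : ∀ a b : U, β ≤ SN F β a b ↔ ∀ e, β ≤ F e a → β ≤ F e b := by
    intro a b
    simp [SN, Finset.le_inf_iff]
  constructor
  · rintro ⟨h1, h2⟩
    have h : ∀ e, β ≤ F e x ↔ β ≤ F e y := fun e =>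
      ⟨(key x y).1 h1 e, (key y x).1 h2 e⟩
    funext z
    simp only [SN, h]
  · intro h
    constructor
    · rw [h]
      exact (key y y).2 fun _ he => he
    · rw [← h]
      exact (key x x).2 fun _ he => he
end

section
/- For all x, y in U, y ∈ N_x if and only if N_y ⊆ N_x (containment of crisp sets). -/
open scoped Classical

/-- `y ∈ N_x` iff `N_y ⊆ N_x`. -/
theorem stmt6 {U ι : Type*} [Fintype U] [Nonempty U] [Fintype ι]
    (F : ι → U → IV) (β : IV) :
    ∀ x y : U, y ∈ Nbd F β x ↔ Nbd F β y ⊆ Nbd F β x := by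
  have key : ∀ x y : U, y ∈ Nbd F β x ↔ ∀ e, β ≤ F e x → β ≤ F e y := by
    intro x y
    simp [Nbd, SN, Finset.le_inf_iff]
  intro x y
  constructor
  · intro h z hz
    rw [key] at *
    exact fun e he => hz e (h e he)
  · intro h
    exact h ((key y y).2 fun e he => he)
end

section
/- For all x, y in U: (1) SN_y ⊆ SN_x if and only if N_y ⊆ N_x; (2) SN_x = SN_y if and only if N_x = N_y. -/
open scoped Classical

theorem Nbd_sub_imp_SN_le {U ι : Type*} [Fintype ι] (F : ι → U → IV) (β : IV) (x y : U)
    (h : Nbd F β y ⊆ Nbd F β x) (z : U) : SN F β y z ≤ SN F β x z := by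
  have hy : y ∈ Nbd F β y := by
    show β ≤ SN F β y y
    unfold SN
    refine Finset.le_inf fun e he => ?_
    exact (Finset.mem_filter.mp he).2
  have hx : β ≤ SN F β x y := h hy
  refine Finset.le_inf fun e he => ?_
  have h1 : β ≤ F e y := hx.trans (Finset.inf_le (f := fun e => F e y) he)
  exact Finset.inf_le (f := fun e => F e z) (Finset.mem_filter.mpr ⟨Finset.mem_univ e, h1⟩)

/-- (1) `SN_y ⊆ SN_x` iff `N_y ⊆ N_x`; (2) `SN_x = SN_y` iff `N_x = N_y`. -/
theorem stmt8 {U ι : Type*} [Fintype U] [Nonempty U] [Fintype ι]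
    (F : ι → U → IV) (β : IV) :
    ∀ x y : U,
      ((∀ z : U, SN F β y z ≤ SN F β x z) ↔ Nbd F β y ⊆ Nbd F β x) ∧
      (SN F β x = SN F β y ↔ Nbd F β x = Nbd F β y) := by
  intro x y
  refine ⟨⟨fun h z hz => le_trans hz (h z), Nbd_sub_imp_SN_le F β x y⟩, fun h => ?_, fun h => ?_⟩
  · unfold Nbd
    rw [h]
  · funext z
    exact le_antisymm (Nbd_sub_imp_SN_le F β y x h.subset z)
      (Nbd_sub_imp_SN_le F β x y h.symm.subset z)
end

section
/- For every interval-valued fuzzy set X on U, the first-kind approximations satisfy the duality laws SA₋₁(Xᶜ) = (SA₊₁(X))ᶜ and SA₊₁(Xᶜ) = (SA₋₁(X))ᶜ. -/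
open scoped Classical

theorem IV.compl_compl' (a : IV) : a.compl.compl = a := by
  apply IV.ext' <;> simp [IV.compl]

theorem IV.compl_inf' (a b : IV) : (a ⊓ b).compl = a.compl ⊔ b.compl := by
  apply IV.ext'
  · change 1 - min a.hi b.hi = max (1 - a.hi) (1 - b.hi)
    grind
  · change 1 - min a.lo b.lo = max (1 - a.lo) (1 - b.lo)
    grind

theorem IV.compl_sup' (a b : IV) : (a ⊔ b).compl = a.compl ⊓ b.compl := by
  apply IV.ext'
  · change 1 - max a.hi b.hi = min (1 - a.hi) (1 - b.hi)
    grind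
  · change 1 - max a.lo b.lo = min (1 - a.lo) (1 - b.lo)
    grind

theorem IV.compl_finset_sup' {U : Type*} {s : Finset U} (hs : s.Nonempty) (f : U → IV) :
    (s.sup' hs f).compl = s.inf' hs (fun y => (f y).compl) := by
  induction hs using Finset.Nonempty.cons_induction with
  | singleton a => simp
  | cons a s ha hs ih => rw [Finset.sup'_cons hs, Finset.inf'_cons hs, IV.compl_sup', ih]

theorem IV.compl_finset_inf' {U : Type*} {s : Finset U} (hs : s.Nonempty) (f : U → IV) :
    (s.inf' hs f).compl = s.sup' hs (fun y => (f y).compl) := by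
  induction hs using Finset.Nonempty.cons_induction with
  | singleton a => simp
  | cons a s ha hs ih => rw [Finset.sup'_cons hs, Finset.inf'_cons hs, IV.compl_inf', ih]

/-- duality laws `SA₋₁(Xᶜ) = (SA₊₁(X))ᶜ` and `SA₊₁(Xᶜ) = (SA₋₁(X))ᶜ`. -/
theorem stmt11 {U ι : Type*} [Fintype U] [Nonempty U] [Fintype ι]
    (F : ι → U → IV) (β : IV) (X : U → IV) :
    SAlow1 F β (fun u => (X u).compl) = (fun u => (SAupp1 F β X u).compl) ∧
    SAupp1 F β (fun u => (X u).compl) = (fun u => (SAlow1 F β X u).compl) := by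
  constructor
  · funext x
    simp only [SAlow1, SAupp1]
    rw [IV.compl_finset_sup' Finset.univ_nonempty]
    simp only [IV.compl_inf']
  · funext x
    simp only [SAlow1, SAupp1]
    rw [IV.compl_finset_inf' Finset.univ_nonempty]
    simp only [IV.compl_sup', IV.compl_compl']
end

section
/- For all interval-valued fuzzy sets X, Y on U, SA₋₁(X ∩ Y) = SA₋₁(X) ∩ SA₋₁(Y) and SA₊₁(X ∪ Y) = SA₊₁(X) ∪ SA₊₁(Y). -/
open scoped Classical

theorem IV.sup_inf_distrib (a b c : IV) : a ⊔ (b ⊓ c) = (a ⊔ b) ⊓ (a ⊔ c) :=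
  IV.ext' (max_min_distrib_left a.lo b.lo c.lo) (max_min_distrib_left a.hi b.hi c.hi)

theorem IV.inf_sup_distrib (a b c : IV) : a ⊓ (b ⊔ c) = (a ⊓ b) ⊔ (a ⊓ c) :=
  IV.ext' (min_max_distrib_left a.lo b.lo c.lo) (min_max_distrib_left a.hi b.hi c.hi)

/-- `SA₋₁(X ∩ Y) = SA₋₁(X) ∩ SA₋₁(Y)` and `SA₊₁(X ∪ Y) = SA₊₁(X) ∪ SA₊₁(Y)`. -/
theorem stmt12 {U ι : Type*} [Fintype U] [Nonempty U] [Fintype ι]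
    (F : ι → U → IV) (β : IV) (X Y : U → IV) :
    SAlow1 F β (fun u => X u ⊓ Y u) = (fun u => SAlow1 F β X u ⊓ SAlow1 F β Y u) ∧
    SAupp1 F β (fun u => X u ⊔ Y u) = (fun u => SAupp1 F β X u ⊔ SAupp1 F β Y u) := by
  constructor
  · funext x
    simp only [SAlow1, IV.sup_inf_distrib]
    refine eq_of_forall_le_iff fun c => ?_
    simp only [Finset.le_inf'_iff, le_inf_iff, forall_and]
  · funext x
    simp only [SAupp1, IV.inf_sup_distrib]
    refine eq_of_forall_ge_iff fun c => ?_
    simp only [Finset.sup'_le_iff, sup_le_iff, forall_and]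
end

section
/- If an interval-valued fuzzy set X on U satisfies (SN_x)ᶜ(x) ≤ X(x) ≤ SN_x(x) for all x ∈ U, then SA₋₁(SA₋₁(X)) ⊆ SA₋₁(X) ⊆ X ⊆ SA₊₁(X) ⊆ SA₊₁(SA₊₁(X)). -/
open scoped Classical

/-- if `(SN_x)ᶜ(x) ≤ X(x) ≤ SN_x(x)` for all `x`, then
`SA₋₁(SA₋₁(X)) ⊆ SA₋₁(X) ⊆ X ⊆ SA₊₁(X) ⊆ SA₊₁(SA₊₁(X))`. -/
theorem stmt14 {U ι : Type*} [Fintype U] [Nonempty U] [Fintype ι]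
    (F : ι → U → IV) (β : IV) (X : U → IV)
    (h : ∀ x : U, (SN F β x x).compl ≤ X x ∧ X x ≤ SN F β x x) :
    (∀ u, SAlow1 F β (SAlow1 F β X) u ≤ SAlow1 F β X u) ∧
    (∀ u, SAlow1 F β X u ≤ X u) ∧
    (∀ u, X u ≤ SAupp1 F β X u) ∧
    (∀ u, SAupp1 F β X u ≤ SAupp1 F β (SAupp1 F β X) u) := by
  have h1 : ∀ u, SAlow1 F β X u ≤ X u := fun u =>
    (Finset.inf'_le (fun y => (SN F β u y).compl ⊔ X y) (Finset.mem_univ u)).trans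
      (sup_le (h u).1 le_rfl)
  have h2 : ∀ u, X u ≤ SAupp1 F β X u := fun u =>
    (le_inf (h u).2 le_rfl).trans
      (Finset.le_sup' (fun y => SN F β u y ⊓ X y) (Finset.mem_univ u))
  refine ⟨fun u => ?_, h1, h2, fun u => ?_⟩
  · exact Finset.le_inf' _ _ fun y hy =>
      (Finset.inf'_le (fun y => (SN F β u y).compl ⊔ SAlow1 F β X y) hy).trans
        (sup_le_sup le_rfl (h1 y))
  · exact Finset.sup'_le _ _ fun y hy =>
      (inf_le_inf le_rfl (h2 y)).trans
        (Finset.le_sup' (fun y => SN F β u y ⊓ SAupp1 F β X y) hy)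
end

section
/- If an interval-valued fuzzy set X on U satisfies (SN_x)ᶜ(x) ≤ X(x) ≤ SN_x(x) for all x ∈ U, then SA₋₄(X) ⊆ SA₋₂(X) ⊆ SA₋₃(X) ⊆ X ⊆ SA₊₃(X) ⊆ SA₊₁(X) ⊆ SA₊₄(X). -/
open scoped Classical

/-- if `(SN_x)ᶜ(x) ≤ X(x) ≤ SN_x(x)` for all `x`, then
`SA₋₄(X) ⊆ SA₋₂(X) ⊆ SA₋₃(X) ⊆ X ⊆ SA₊₃(X) ⊆ SA₊₁(X) ⊆ SA₊₄(X)`. -/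
theorem stmt19 {U ι : Type*} [Fintype U] [Nonempty U] [Fintype ι]
    (F : ι → U → IV) (β : IV) (X : U → IV)
    (h : ∀ x : U, (SN F β x x).compl ≤ X x ∧ X x ≤ SN F β x x) :
    (∀ u, SAlow4 F β X u ≤ SAlow2 F β X u) ∧
    (∀ u, SAlow2 F β X u ≤ SAlow3 F β X u) ∧
    (∀ u, SAlow3 F β X u ≤ X u) ∧
    (∀ u, X u ≤ SAupp3 F β X u) ∧
    (∀ u, SAupp3 F β X u ≤ SAupp1 F β X u) ∧
    (∀ u, SAupp1 F β X u ≤ SAupp4 F β X u) := by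
  refine ⟨fun u => ?_, fun u => ?_, fun u => ?_, fun u => ?_, fun u => ?_, fun u => ?_⟩
  · exact Finset.le_inf' _ _ fun y hy => (Finset.inf'_le _ hy).trans
      (sup_le_sup_right inf_le_right _)
  · exact Finset.le_inf' _ _ fun y hy => (Finset.inf'_le _ hy).trans
      (sup_le_sup_right le_sup_right _)
  · exact (Finset.inf'_le _ (Finset.mem_univ u)).trans
      (sup_le (sup_le (h u).1 (h u).1) le_rfl)
  · exact le_trans (le_inf (le_inf (h u).2 (h u).2) le_rfl)
      (Finset.le_sup' (fun y => SN F β u y ⊓ SM F β u y ⊓ X y) (Finset.mem_univ u))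
  · exact Finset.sup'_le _ _ fun y hy => le_trans (inf_le_inf_right _ inf_le_left)
      (Finset.le_sup' (fun y => SN F β u y ⊓ X y) hy)
  · exact Finset.sup'_le _ _ fun y hy => le_trans (inf_le_inf_right _ le_sup_left)
      (Finset.le_sup' (fun y => (SN F β u y ⊔ SM F β u y) ⊓ X y) hy)
end
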